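/- arXiv:1212.2818 — 5 statements merged into one kernel-verified Lean document; each statement's English description precedes it below -/
import Mathlib

section
/- Let m be a positive integer, let z₁,…,z_m be complex numbers such that exp(z_h/k) ≠ 1 for every h ∈ {1,…,m} and every positive integer k, and let (a_k)_{k≥1} be a complex sequence with Σ_{n=1}^∞ n^{m+1}|a_n| < ∞. For each k ≥ 1 set S_k = Σ_{j=1}^∞ a_{jk}. Then Σ_{k=1}^∞ a_k ∏_{h=1}^m (1−exp(z_h))/(1−exp(z_h/k)) = S₁ + Σ_{k=2}^∞ S_k · Σ_{(j₁,…,j_m)} exp((j₁z₁+⋯+j_m z_m)/k), where the inner sum ranges over all m-tuples (j₁,…,j_m) of integers with 0 ≤ j_i < k, (j₁,…,j_m) ≠ (0,…,0), and gcd(j₁,…,j_m,k) = 1, and all series involved converge absolutely. -/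
/-- `S_k = Σ_{j=1}^∞ a_{jk}`. -/
noncomputable def multipleSum (a : ℕ → ℂ) (k : ℕ) : ℂ := ∑' j : ℕ, a ((j + 1) * k)

/-- The sum of `exp((j₁z₁+⋯+j_mz_m)/k)` over all `m`-tuples `(j₁,…,j_m)` of
integers with `0 ≤ jᵢ < k`, `(j₁,…,j_m) ≠ (0,…,0)` and `gcd(j₁,…,j_m,k) = 1`. -/
noncomputable def visibleExpSum (m k : ℕ) (z : Fin m → ℂ) : ℂ :=
  ∑ j ∈ Finset.univ.filter (fun j : Fin m → Fin k =>
      (∃ i, (j i : ℕ) ≠ 0) ∧ Nat.gcd (Finset.univ.gcd fun i => (j i : ℕ)) k = 1),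
    Complex.exp ((∑ i, ((j i : ℕ) : ℂ) * z i) / k)

open Finset

/-- The points `p ∈ {0, …, d - 1}^ι` such that `(p, d)` is a visible lattice point. -/
def visiblePoints (ι : Type*) [Fintype ι] [DecidableEq ι] (d : ℕ) : Finset (ι → ℕ) :=
  (Fintype.piFinset fun _ => range d).filter fun p => Nat.gcd (univ.gcd p) d = 1

/-- The points of the lattice cube `{0, …, n - 1}^ι` at height `n` are grouped as multiples of
visible points at heights dividing `n`. -/
theorem sum_piFinset_range_eq_sum_divisors_visiblePoints {ι M : Type*} [Fintype ι]
    [DecidableEq ι] [AddCommMonoid M] (f : (ι → ℚ) → M) {n : ℕ} (hn : n ≠ 0) :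
    ∑ j ∈ Fintype.piFinset (fun _ : ι => range n), f (fun i => (j i : ℚ) / n) =
      ∑ d ∈ n.divisors, ∑ p ∈ visiblePoints ι d, f (fun i => (p i : ℚ) / d) := by
  have hg (j : ι → ℕ) : 0 < Nat.gcd (univ.gcd j) n := Nat.gcd_pos_of_pos_right _ (by omega)
  have hgn (j : ι → ℕ) : Nat.gcd (univ.gcd j) n ∣ n := Nat.gcd_dvd_right _ _
  have hgj (j : ι → ℕ) (i : ι) : Nat.gcd (univ.gcd j) n ∣ j i :=
    (Nat.gcd_dvd_left _ _).trans (Finset.gcd_dvd (mem_univ i))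
  have gcd_mul (c : ℕ) (p : ι → ℕ) (d : ℕ) :
      Nat.gcd (univ.gcd fun i => c * p i) (c * d) = c * Nat.gcd (univ.gcd p) d := by
    rw [Finset.gcd_mul_left, normalize_eq, Nat.gcd_mul_left]
  rw [sum_sigma']
  refine sum_bij'
    (fun j _ => (⟨n / Nat.gcd (univ.gcd j) n, fun i => j i / Nat.gcd (univ.gcd j) n⟩ :
      (_ : ℕ) × (ι → ℕ)))
    (fun x _ i => n / x.1 * x.2 i) ?_ ?_ ?_ ?_ ?_
  · intro j hj
    simp only [Fintype.mem_piFinset, mem_range] at hj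
    simp only [mem_sigma, Nat.mem_divisors, visiblePoints, mem_filter, Fintype.mem_piFinset,
      mem_range]
    refine ⟨⟨Nat.div_dvd_of_dvd (hgn j), hn⟩,
      fun i => Nat.div_lt_div_of_lt_of_dvd (hgn j) (hj i), ?_⟩
    apply Nat.eq_of_mul_eq_mul_left (hg j)
    rw [← gcd_mul, mul_one, Nat.mul_div_cancel' (hgn j)]
    simp only [Nat.mul_div_cancel' (hgj j _)]
  · rintro ⟨d, p⟩ h
    simp only [mem_sigma, Nat.mem_divisors, visiblePoints, mem_filter, Fintype.mem_piFinset,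
      mem_range] at h ⊢
    intro i
    have hpos : 0 < n / d := Nat.div_pos (Nat.le_of_dvd (by omega) h.1.1)
      (Nat.pos_of_dvd_of_pos h.1.1 (by omega))
    calc n / d * p i < n / d * d := Nat.mul_lt_mul_of_pos_left (h.2.1 i) hpos
      _ = n := Nat.div_mul_cancel h.1.1
  · intro j _
    funext i
    simp only [Nat.div_div_self (hgn j) hn, Nat.mul_div_cancel' (hgj j _)]
  · rintro ⟨d, p⟩ h
    simp only [mem_sigma, Nat.mem_divisors, visiblePoints, mem_filter, Fintype.mem_piFinset,
      mem_range] at h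
    obtain ⟨⟨⟨c, rfl⟩, -⟩, -, hp⟩ := h
    obtain ⟨hd, hc⟩ := mul_ne_zero_iff.mp hn
    have key : Nat.gcd (univ.gcd fun i => c * p i) (d * c) = c := by
      rw [mul_comm d c, gcd_mul, hp, mul_one]
    simp only [Nat.mul_div_cancel_left c (Nat.pos_of_ne_zero hd), key,
      Nat.mul_div_cancel _ (Nat.pos_of_ne_zero hc),
      Nat.mul_div_cancel_left _ (Nat.pos_of_ne_zero hc)]
  · intro j _
    congr 1
    funext i
    have : (Nat.gcd (univ.gcd j) n : ℚ) ≠ 0 := by exact_mod_cast (hg j).ne'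
    rw [Nat.cast_div (hgj j i) this, Nat.cast_div (hgn j) this, div_div_div_cancel_right₀ this]

/-- The sum of `exp ((p ⬝ z) / d)` over the visible points `p` at height `d`. -/
noncomputable def visibleSum {ι : Type*} [Fintype ι] [DecidableEq ι] (z : ι → ℂ) (d : ℕ) : ℂ :=
  ∑ p ∈ visiblePoints ι d, Complex.exp (∑ i, ((p i : ℚ) / d : ℚ) * z i)

theorem visibleSum_one {ι : Type*} [Fintype ι] [DecidableEq ι] (z : ι → ℂ) :
    visibleSum z 1 = 1 := by
  have : visiblePoints ι 1 = {0} := by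
    ext p
    simp [visiblePoints, funext_iff]
  simp [visibleSum, this]

theorem visibleExpSum_eq_visibleSum {m k : ℕ} (hk : 2 ≤ k) (z : Fin m → ℂ) :
    visibleExpSum m k z = visibleSum z k := by
  refine sum_bij (fun j _ i => (j i : ℕ)) ?_ ?_ ?_ ?_
  · intro j hj
    simp only [mem_filter, mem_univ, true_and] at hj
    simpa [visiblePoints] using hj.2
  · intro j _ j' _ h
    funext i
    exact Fin.ext (congrFun h i)
  · intro p hp
    simp only [visiblePoints, mem_filter, Fintype.mem_piFinset, mem_range] at hp
    refine ⟨fun i => ⟨p i, hp.1 i⟩, ?_, rfl⟩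
    simp only [mem_filter, mem_univ, true_and]
    refine ⟨?_, hp.2⟩
    by_contra! h
    rw [Finset.gcd_eq_zero_iff.mpr fun i _ => h i, Nat.gcd_zero_left] at hp
    omega
  · intro j _
    congr 1
    rw [sum_div]
    refine sum_congr rfl fun i _ => ?_
    push_cast
    ring

theorem sum_divisors_visibleSum {ι : Type*} [Fintype ι] [DecidableEq ι] (z : ι → ℂ) {n : ℕ}
    (hn : n ≠ 0) (hz : ∀ h, Complex.exp (z h / n) ≠ 1) :
    ∑ d ∈ n.divisors, visibleSum z d =
      ∏ h, (1 - Complex.exp (z h)) / (1 - Complex.exp (z h / n)) := by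
  have hfactor (h : ι) : (1 - Complex.exp (z h)) / (1 - Complex.exp (z h / n)) =
      ∑ j ∈ range n, Complex.exp (z h / n) ^ j := by
    rw [geom_sum_eq (hz h), ← Complex.exp_nat_mul, mul_div_cancel₀ _ (Nat.cast_ne_zero.mpr hn),
      ← neg_div_neg_eq, neg_sub, neg_sub]
  simp_rw [hfactor, prod_univ_sum, visibleSum]
  rw [← sum_piFinset_range_eq_sum_divisors_visiblePoints
    (fun x : ι → ℚ => Complex.exp (∑ i, (x i : ℂ) * z i)) hn]
  refine sum_congr rfl fun j _ => ?_
  rw [Complex.exp_sum]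
  refine prod_congr rfl fun i _ => ?_
  rw [← Complex.exp_nat_mul]
  congr 1
  push_cast
  ring

theorem norm_visibleSum_le {ι : Type*} [Fintype ι] [DecidableEq ι] (z : ι → ℂ) (d : ℕ) :
    ‖visibleSum z d‖ ≤ d ^ Fintype.card ι * Real.exp (∑ i, ‖z i‖) := by
  have hterm : ∀ p ∈ visiblePoints ι d,
      ‖Complex.exp (∑ i, ((p i : ℚ) / d : ℚ) * z i)‖ ≤ Real.exp (∑ i, ‖z i‖) := by
    intro p hp
    simp only [visiblePoints, mem_filter, Fintype.mem_piFinset, mem_range] at hp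
    refine (Complex.norm_exp_le_exp_norm _).trans (Real.exp_le_exp.mpr ?_)
    refine (norm_sum_le _ _).trans (sum_le_sum fun i _ => ?_)
    rw [norm_mul]
    refine mul_le_of_le_one_left (norm_nonneg _) ?_
    push_cast
    rw [norm_div, Complex.norm_natCast, Complex.norm_natCast]
    exact div_le_one_of_le₀ (by exact_mod_cast (hp.1 i).le) (Nat.cast_nonneg d)
  calc ‖visibleSum z d‖ ≤ #(visiblePoints ι d) • Real.exp (∑ i, ‖z i‖) :=
        norm_sum_le_of_le _ hterm |>.trans_eq (sum_const _)
    _ ≤ d ^ Fintype.card ι * Real.exp (∑ i, ‖z i‖) := by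
        rw [nsmul_eq_mul]
        gcongr
        have : #(visiblePoints ι d) ≤ d ^ Fintype.card ι := by
          refine (card_filter_le _ _).trans_eq ?_
          simp
        exact_mod_cast this

/-- If `‖w d‖ ≤ C * d ^ m` and `∑ n ^ (m + 1) * ‖a n‖` converges, then the double series
`∑ a (d * e) * w d` converges absolutely. -/
theorem summable_mul_prod_of_norm_le {a w : ℕ → ℂ} {m : ℕ} {C : ℝ}
    (ha : Summable fun n : ℕ => (n : ℝ) ^ (m + 1) * ‖a n‖) (hw : ∀ d, ‖w d‖ ≤ d ^ m * C) :
    Summable fun x : ℕ+ × ℕ+ => a (x.1 * x.2) * w x.1 := by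
  have hC : 0 ≤ C := by simpa using (norm_nonneg _).trans (hw 1)
  apply Summable.of_norm
  rw [← sigmaAntidiagonalEquivProd.summable_iff,
    summable_sigma_of_nonneg fun _ => by exact norm_nonneg _]
  refine ⟨fun n => (hasSum_fintype _).summable, ?_⟩
  refine .of_nonneg_of_le (fun n => tsum_nonneg fun _ => norm_nonneg _) (fun n => ?_)
    ((ha.mul_left C).comp_injective PNat.coe_injective)
  rw [tsum_fintype]
  have hterm (y : (n : ℕ).divisorsAntidiagonal) :
      ‖a (y.1.1 * y.1.2) * w y.1.1‖ ≤ ‖a n‖ * ((n : ℝ) ^ m * C) := by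
    obtain ⟨hy, -⟩ := Nat.mem_divisorsAntidiagonal.mp y.2
    rw [hy, norm_mul]
    gcongr
    refine (hw _).trans ?_
    gcongr
    exact Nat.le_of_dvd n.pos ⟨_, hy.symm⟩
  have hcard : (Fintype.card (n : ℕ).divisorsAntidiagonal : ℝ) ≤ n := by
    rw [Fintype.card_coe, ← Nat.map_div_right_divisors, card_map]
    exact_mod_cast Nat.card_divisors_le_self n
  calc _ ≤ ∑ _y : (n : ℕ).divisorsAntidiagonal, ‖a n‖ * ((n : ℝ) ^ m * C) :=
        sum_le_sum fun y _ => hterm y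
    _ = Fintype.card (n : ℕ).divisorsAntidiagonal * (‖a n‖ * ((n : ℝ) ^ m * C)) := by simp
    _ ≤ n * (‖a n‖ * ((n : ℝ) ^ m * C)) := by gcongr
    _ = C * ((n : ℝ) ^ (m + 1) * ‖a n‖) := by ring

theorem hasSum_multipleSum_mul {a w : ℕ → ℂ}
    (h : Summable fun x : ℕ+ × ℕ+ => a (x.1 * x.2) * w x.1) :
    HasSum (fun d : ℕ+ => multipleSum a d * w d) (∑' x : ℕ+ × ℕ+, a (x.1 * x.2) * w x.1) := by
  convert h.hasSum.prod_fiberwise fun d => (h.prod_factor d).hasSum using 2 with d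
  rw [multipleSum, ← tsum_pnat_eq_tsum_succ (f := fun j => a (j * d)), ← tsum_mul_right]
  simp only [mul_comm (d : ℕ)]

theorem hasSum_mul_sum_divisors {a w : ℕ → ℂ}
    (h : Summable fun x : ℕ+ × ℕ+ => a (x.1 * x.2) * w x.1) :
    HasSum (fun n : ℕ+ => a n * ∑ d ∈ (n : ℕ).divisors, w d)
      (∑' x : ℕ+ × ℕ+, a (x.1 * x.2) * w x.1) := by
  refine (sigmaAntidiagonalEquivProd.hasSum_iff.mpr h.hasSum).sigma fun n => ?_
  convert hasSum_fintype _ using 1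
  rw [mul_sum, ← Nat.sum_divisorsAntidiagonal (fun d _ => a n * w d), ← sum_coe_sort]
  refine sum_congr rfl fun y _ => ?_
  exact congrArg (fun k => a k * w y.1.1) (Nat.mem_divisorsAntidiagonal.mp y.2).1.symm

/-- The analytic form of the visible point lemma:
`Σ_{k=1}^∞ a_k ∏_{h=1}^m (1−e^{z_h})/(1−e^{z_h/k})
  = S₁ + Σ_{k=2}^∞ S_k Σ_{(j₁,…,j_m)} e^{(j₁z₁+⋯+j_mz_m)/k}`,
all series converging absolutely (`HasSum`/`Summable` in `ℂ`). -/
theorem visible_point_summation (m : ℕ) (hm : 0 < m) (z : Fin m → ℂ)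
    (hz : ∀ h, ∀ k : ℕ, 0 < k → Complex.exp (z h / (k : ℂ)) ≠ 1)
    (a : ℕ → ℂ) (ha : Summable fun n : ℕ => (n : ℝ) ^ (m + 1) * ‖a n‖) :
    Summable (fun k : ℕ => multipleSum a (k + 2) * visibleExpSum m (k + 2) z) ∧
    HasSum (fun k : ℕ =>
        a (k + 1) * ∏ h, (1 - Complex.exp (z h)) / (1 - Complex.exp (z h / ((k + 1 : ℕ) : ℂ))))
      (multipleSum a 1 + ∑' k : ℕ, multipleSum a (k + 2) * visibleExpSum m (k + 2) z) := by
  have hsum : Summable fun x : ℕ+ × ℕ+ => a (x.1 * x.2) * visibleSum z x.1 :=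
    summable_mul_prod_of_norm_le ha fun d => by simpa using norm_visibleSum_le z d
  have hS := hasSum_pnat_iff_hasSum_succ
    (f := fun d => multipleSum a d * visibleSum z d) |>.mp (hasSum_multipleSum_mul hsum)
  have hT := hasSum_pnat_iff_hasSum_succ
    (f := fun n => a n * ∑ d ∈ n.divisors, visibleSum z d) |>.mp (hasSum_mul_sum_divisors hsum)
  have hw (k : ℕ) : visibleExpSum m (k + 2) z = visibleSum z (k + 2) :=
    visibleExpSum_eq_visibleSum (Nat.le_add_left 2 k) z
  have hprod (k : ℕ) :
      ∏ h, (1 - Complex.exp (z h)) / (1 - Complex.exp (z h / ((k + 1 : ℕ) : ℂ))) =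
        ∑ d ∈ (k + 1).divisors, visibleSum z d :=
    (sum_divisors_visibleSum z k.succ_ne_zero fun h => hz h _ k.succ_pos).symm
  have htail : multipleSum a 1 + ∑' k : ℕ, multipleSum a (k + 2) * visibleSum z (k + 2) =
      ∑' x : ℕ+ × ℕ+, a (x.1 * x.2) * visibleSum z x.1 := by
    rw [← hS.tsum_eq, hS.summable.tsum_eq_zero_add, zero_add, visibleSum_one, mul_one]
  simp only [hw, hprod, htail]
  refine ⟨?_, hT⟩
  exact (summable_nat_add_iff (f := fun k => multipleSum a (k + 1) * visibleSum z (k + 1)) 1).mpr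
    hS.summable
end

section
/- Let n be a positive integer, let x, y be complex numbers, and let (a_k)_{k≥1} be a complex sequence with Σ_{k=1}^∞ k³|a_k| < ∞. For each k ≥ 1 set S_k = Σ_{j=1}^∞ a_{jk}. Then Σ_{k=1}^∞ (a_k/kⁿ) Σ_{(A,B)} (Ax+By)ⁿ = Σ_{k=2}^∞ (S_k/kⁿ) Σ_{(j₁,j₂)} (j₁x+j₂y)ⁿ, where the first inner sum ranges over all pairs of integers (A,B) with 0 ≤ A < k, 0 ≤ B < k and (A,B) ≠ (0,0), and the second inner sum ranges over all pairs of integers (j₁,j₂) with 0 ≤ j₁ < k, 0 ≤ j₂ < k, (j₁,j₂) ≠ (0,0) and gcd(j₁,j₂,k) = 1; all series involved converge absolutely. -/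
/-- Pairs of integers `(A,B)` with `0 ≤ A < k`, `0 ≤ B < k`, `(A,B) ≠ (0,0)`. -/
def nonzeroPairs (k : ℕ) : Finset (Fin k × Fin k) :=
  Finset.univ.filter fun p => (p.1 : ℕ) ≠ 0 ∨ (p.2 : ℕ) ≠ 0

/-- Pairs of integers `(j₁,j₂)` with `0 ≤ j₁,j₂ < k`, `(j₁,j₂) ≠ (0,0)` and
`gcd(j₁,j₂,k) = 1`. -/
def visiblePairs (k : ℕ) : Finset (Fin k × Fin k) :=
  Finset.univ.filter fun p =>
    ((p.1 : ℕ) ≠ 0 ∨ (p.2 : ℕ) ≠ 0) ∧ Nat.gcd (Nat.gcd (p.1 : ℕ) (p.2 : ℕ)) k = 1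

/-- The normalized power sum `Σ_{(A,B) ∈ s} ((Ax+By)/k)ⁿ` over a set of pairs modulo `k`. -/
noncomputable def normalizedPowerSum (n : ℕ) (x y : ℂ) {k : ℕ} (s : Finset (Fin k × Fin k)) : ℂ :=
  ∑ p ∈ s, ((((p.1 : ℕ) : ℂ) * x + ((p.2 : ℕ) : ℂ) * y) / (k : ℂ)) ^ n

theorem div_pow_mul_sum_eq_mul_normalizedPowerSum (n : ℕ) (x y c : ℂ) {k : ℕ}
    (s : Finset (Fin k × Fin k)) :
    c / (k : ℂ) ^ n * ∑ p ∈ s, (((p.1 : ℕ) : ℂ) * x + ((p.2 : ℕ) : ℂ) * y) ^ n =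
      c * normalizedPowerSum n x y s := by
  simp only [normalizedPowerSum, div_pow, ← Finset.sum_div]
  ring

theorem norm_normalizedPowerSum_le (n : ℕ) (x y : ℂ) {k : ℕ} (s : Finset (Fin k × Fin k)) :
    ‖normalizedPowerSum n x y s‖ ≤ (k : ℝ) ^ 2 * (‖x‖ + ‖y‖) ^ n := by
  have hterm : ∀ p ∈ s,
      ‖((((p.1 : ℕ) : ℂ) * x + ((p.2 : ℕ) : ℂ) * y) / (k : ℂ)) ^ n‖ ≤ (‖x‖ + ‖y‖) ^ n := by
    intro p _
    have hk : (0 : ℝ) < k := by exact_mod_cast p.1.pos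
    have h1 : ((p.1 : ℕ) : ℝ) ≤ k := by exact_mod_cast p.1.isLt.le
    have h2 : ((p.2 : ℕ) : ℝ) ≤ k := by exact_mod_cast p.2.isLt.le
    rw [norm_pow, norm_div, Complex.norm_natCast]
    gcongr
    rw [div_le_iff₀ hk]
    calc ‖((p.1 : ℕ) : ℂ) * x + ((p.2 : ℕ) : ℂ) * y‖
        ≤ (p.1 : ℕ) * ‖x‖ + (p.2 : ℕ) * ‖y‖ := by
          refine (norm_add_le _ _).trans_eq ?_
          simp only [norm_mul, Complex.norm_natCast]
      _ ≤ k * ‖x‖ + k * ‖y‖ := by gcongr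
      _ = (‖x‖ + ‖y‖) * k := by ring
  have hcard : (s.card : ℝ) ≤ (k : ℝ) ^ 2 := by
    have h := s.card_le_univ
    rw [Fintype.card_prod, Fintype.card_fin, ← pow_two] at h
    exact_mod_cast h
  calc ‖normalizedPowerSum n x y s‖ ≤ s.card • (‖x‖ + ‖y‖) ^ n :=
        (norm_sum_le _ _).trans (Finset.sum_le_card_nsmul _ _ _ hterm)
    _ ≤ (k : ℝ) ^ 2 * (‖x‖ + ‖y‖) ^ n := by
        rw [nsmul_eq_mul]
        gcongr

/-- The pairs `(A,B)` with `gcd(A,B,dm) = d` are the multiples by `d` of the visible pairs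
modulo `m`. -/
theorem sum_filter_gcd_eq_normalizedPowerSum_visiblePairs (n : ℕ) (x y : ℂ) {d m : ℕ}
    (hd : 0 < d) :
    ∑ p ∈ nonzeroPairs (d * m) with Nat.gcd (Nat.gcd (p.1 : ℕ) (p.2 : ℕ)) (d * m) = d,
        ((((p.1 : ℕ) : ℂ) * x + ((p.2 : ℕ) : ℂ) * y) / ((d * m : ℕ) : ℂ)) ^ n =
      normalizedPowerSum n x y (visiblePairs m) := by
  symm
  refine Finset.sum_nbij'
    (fun q => (⟨d * q.1, Nat.mul_lt_mul_of_pos_left q.1.isLt hd⟩,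
      ⟨d * q.2, Nat.mul_lt_mul_of_pos_left q.2.isLt hd⟩))
    (fun p => (⟨p.1 / d, Nat.div_lt_of_lt_mul p.1.isLt⟩,
      ⟨p.2 / d, Nat.div_lt_of_lt_mul p.2.isLt⟩)) ?_ ?_ ?_ ?_ ?_
  · rintro ⟨q₁, q₂⟩ hq
    simp only [visiblePairs, nonzeroPairs, Finset.mem_filter, Finset.mem_univ, true_and] at hq ⊢
    rw [Nat.gcd_mul_left, Nat.gcd_mul_left, hq.2]
    simpa [hd.ne'] using hq.1
  · rintro ⟨p₁, p₂⟩ hp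
    simp only [visiblePairs, nonzeroPairs, Finset.mem_filter, Finset.mem_univ, true_and] at hp ⊢
    obtain ⟨h0, hg⟩ := hp
    have hdvd : d ∣ Nat.gcd p₁ p₂ := hg.symm.dvd.trans (Nat.gcd_dvd_left _ _)
    obtain ⟨u, hu⟩ := hdvd.trans (Nat.gcd_dvd_left _ _)
    obtain ⟨v, hv⟩ := hdvd.trans (Nat.gcd_dvd_right _ _)
    rw [hu, hv, Nat.gcd_mul_left, Nat.gcd_mul_left] at hg
    rw [hu, hv, Nat.mul_div_cancel_left _ hd, Nat.mul_div_cancel_left _ hd]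
    refine ⟨?_, Nat.eq_of_mul_eq_mul_left hd (by rw [hg, mul_one])⟩
    rw [hu, hv] at h0
    simpa [hd.ne'] using h0
  · rintro ⟨q₁, q₂⟩ _
    simp [Nat.mul_div_cancel_left _ hd]
  · rintro ⟨p₁, p₂⟩ hp
    simp only [Finset.mem_filter] at hp
    have hdvd : d ∣ Nat.gcd p₁ p₂ := hp.2.symm.dvd.trans (Nat.gcd_dvd_left _ _)
    ext
    · exact Nat.mul_div_cancel' (hdvd.trans (Nat.gcd_dvd_left _ _))
    · exact Nat.mul_div_cancel' (hdvd.trans (Nat.gcd_dvd_right _ _))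
  · rintro ⟨q₁, q₂⟩ _
    have hd' : (d : ℂ) ≠ 0 := by exact_mod_cast hd.ne'
    congr 1
    push_cast
    rw [← mul_div_mul_left _ (m : ℂ) hd']
    ring

theorem normalizedPowerSum_nonzeroPairs (n : ℕ) (x y : ℂ) {k : ℕ} (hk : k ≠ 0) :
    normalizedPowerSum n x y (nonzeroPairs k) =
      ∑ e ∈ k.divisorsAntidiagonal, normalizedPowerSum n x y (visiblePairs e.2) := by
  have hmaps : ∀ p ∈ nonzeroPairs k, Nat.gcd (Nat.gcd (p.1 : ℕ) (p.2 : ℕ)) k ∈ k.divisors :=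
    fun p _ => Nat.mem_divisors.2 ⟨Nat.gcd_dvd_right _ _, hk⟩
  rw [normalizedPowerSum, ← Finset.sum_fiberwise_of_maps_to hmaps,
    Nat.sum_divisorsAntidiagonal (fun _ m => normalizedPowerSum n x y (visiblePairs m))]
  refine Finset.sum_congr rfl fun d hd => ?_
  obtain ⟨m, rfl⟩ := (Nat.mem_divisors.1 hd).1
  have hd0 : 0 < d := Nat.pos_of_mem_divisors hd
  rw [Nat.mul_div_cancel_left _ hd0, ← sum_filter_gcd_eq_normalizedPowerSum_visiblePairs n x y hd0]

theorem normalizedPowerSum_visiblePairs_one (n : ℕ) (x y : ℂ) :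
    normalizedPowerSum n x y (visiblePairs 1) = 0 := by
  have h : visiblePairs 1 = ∅ := by
    ext p
    simp [visiblePairs]
  simp [normalizedPowerSum, h]

theorem summable_mul_normalizedPowerSum_visiblePairs (n : ℕ) (x y : ℂ) {a : ℕ → ℂ}
    (ha : Summable fun k : ℕ => (k : ℝ) ^ 3 * ‖a k‖) :
    Summable fun e : ℕ+ × ℕ+ =>
      a (e.1 * e.2) * normalizedPowerSum n x y (visiblePairs (e.2 : ℕ)) := by
  rw [← sigmaAntidiagonalEquivProd.summable_iff]
  refine Summable.of_norm_bounded
    (g := fun s => (((s.1 : ℕ) : ℝ) ^ 2 * ‖a s.1‖) * (‖x‖ + ‖y‖) ^ n) ?_ ?_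
  · refine Summable.mul_right _ ((summable_sigma_of_nonneg fun s => by positivity).2
      ⟨fun k => (hasSum_fintype _).summable, ?_⟩)
    have ha' : Summable fun k : ℕ+ => ((k : ℕ) : ℝ) ^ 3 * ‖a k‖ :=
      ha.comp_injective PNat.coe_injective
    refine Summable.of_nonneg_of_le (fun k => tsum_nonneg fun _ => by positivity) (fun k => ?_) ha'
    have hcard : (((k : ℕ).divisorsAntidiagonal.card : ℕ) : ℝ) ≤ (k : ℕ) := by
      rw [← Nat.map_div_right_divisors, Finset.card_map]
      exact_mod_cast Nat.card_divisors_le_self k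
    simp only [tsum_fintype, Finset.sum_const, Finset.card_univ, Fintype.card_coe, nsmul_eq_mul]
    calc _ ≤ ((k : ℕ) : ℝ) * (((k : ℕ) : ℝ) ^ 2 * ‖a k‖) := by gcongr
      _ = _ := by ring
  · rintro ⟨k, ⟨⟨d, m⟩, h⟩⟩
    obtain ⟨hk, -⟩ := Nat.mem_divisorsAntidiagonal.1 h
    have hmk : m ≤ (k : ℕ) := Nat.le_of_dvd k.pos (Dvd.intro_left d hk)
    change ‖a (d * m) * normalizedPowerSum n x y (visiblePairs m)‖ ≤ _
    change d * m = k at hk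
    rw [hk, norm_mul]
    calc _ ≤ ‖a k‖ * ((m : ℝ) ^ 2 * (‖x‖ + ‖y‖) ^ n) := by
          gcongr
          exact norm_normalizedPowerSum_le n x y _
      _ ≤ ‖a k‖ * (((k : ℕ) : ℝ) ^ 2 * (‖x‖ + ‖y‖) ^ n) := by gcongr
      _ = _ := by ring

theorem hasSum_mul_normalizedPowerSum_nonzeroPairs (n : ℕ) (x y : ℂ) {a : ℕ → ℂ}
    (ha : Summable fun k : ℕ => (k : ℝ) ^ 3 * ‖a k‖) :
    HasSum (fun k : ℕ => a (k + 1) * normalizedPowerSum n x y (nonzeroPairs (k + 1)))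
      (∑' e : ℕ+ × ℕ+, a (e.1 * e.2) * normalizedPowerSum n x y (visiblePairs (e.2 : ℕ))) := by
  have h := (sigmaAntidiagonalEquivProd.hasSum_iff.2
    (summable_mul_normalizedPowerSum_visiblePairs n x y ha).hasSum).sigma
    fun k => hasSum_fintype _
  rw [← Equiv.pnatEquivNat.symm.hasSum_iff] at h
  convert h using 1
  funext k
  change _ = ∑ e : (k + 1).divisorsAntidiagonal,
    a (e.1.1 * e.1.2) * normalizedPowerSum n x y (visiblePairs e.1.2)
  rw [Finset.sum_coe_sort _ (fun e : ℕ × ℕ =>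
      a (e.1 * e.2) * normalizedPowerSum n x y (visiblePairs e.2)),
    normalizedPowerSum_nonzeroPairs n x y k.succ_ne_zero, Finset.mul_sum]
  refine Finset.sum_congr rfl fun e he => ?_
  rw [(Nat.mem_divisorsAntidiagonal.1 he).1]

theorem hasSum_multipleSum_mul_normalizedPowerSum_visiblePairs (n : ℕ) (x y : ℂ) {a : ℕ → ℂ}
    (ha : Summable fun k : ℕ => (k : ℝ) ^ 3 * ‖a k‖) :
    HasSum (fun k : ℕ => multipleSum a (k + 2) * normalizedPowerSum n x y (visiblePairs (k + 2)))
      (∑' e : ℕ+ × ℕ+, a (e.1 * e.2) * normalizedPowerSum n x y (visiblePairs (e.2 : ℕ))) := by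
  have hs := (Equiv.prodComm ℕ+ ℕ+).hasSum_iff.2
    (summable_mul_normalizedPowerSum_visiblePairs n x y ha).hasSum
  have h := hs.prod_fiberwise fun m => (hs.summable.prod_factor m).hasSum
  rw [← Equiv.pnatEquivNat.symm.hasSum_iff, ← hasSum_nat_add_iff' 1] at h
  convert h using 1
  · rfl
  · funext k
    change _ = ∑' d : ℕ+, a (d * (k + 2)) * normalizedPowerSum n x y (visiblePairs (k + 2))
    rw [tsum_mul_right, multipleSum, tsum_pnat_eq_tsum_succ (f := fun d => a (d * (k + 2)))]
  · have h1 : ∑' d : ℕ+, a (d * 1) * normalizedPowerSum n x y (visiblePairs 1) = 0 := by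
      simp [normalizedPowerSum_visiblePairs_one]
    rw [Finset.sum_range_one]
    exact (sub_eq_self.2 h1).symm

/-- `Σ_{k=1}^∞ (a_k/kⁿ) Σ_{(A,B)} (Ax+By)ⁿ = Σ_{k=2}^∞ (S_k/kⁿ) Σ_{(j₁,j₂)} (j₁x+j₂y)ⁿ`,
both series converging absolutely. -/
theorem visible_point_power_summation (n : ℕ) (hn : 0 < n) (x y : ℂ) (a : ℕ → ℂ)
    (ha : Summable fun k : ℕ => (k : ℝ) ^ 3 * ‖a k‖) :
    Summable (fun k : ℕ => a (k + 1) / ((k + 1 : ℕ) : ℂ) ^ n *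
        ∑ p ∈ nonzeroPairs (k + 1), (((p.1 : ℕ) : ℂ) * x + ((p.2 : ℕ) : ℂ) * y) ^ n) ∧
    Summable (fun k : ℕ => multipleSum a (k + 2) / ((k + 2 : ℕ) : ℂ) ^ n *
        ∑ p ∈ visiblePairs (k + 2), (((p.1 : ℕ) : ℂ) * x + ((p.2 : ℕ) : ℂ) * y) ^ n) ∧
    (∑' k : ℕ, a (k + 1) / ((k + 1 : ℕ) : ℂ) ^ n *
        ∑ p ∈ nonzeroPairs (k + 1), (((p.1 : ℕ) : ℂ) * x + ((p.2 : ℕ) : ℂ) * y) ^ n) =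
      ∑' k : ℕ, multipleSum a (k + 2) / ((k + 2 : ℕ) : ℂ) ^ n *
        ∑ p ∈ visiblePairs (k + 2), (((p.1 : ℕ) : ℂ) * x + ((p.2 : ℕ) : ℂ) * y) ^ n := by
  simp only [div_pow_mul_sum_eq_mul_normalizedPowerSum]
  have hl := hasSum_mul_normalizedPowerSum_nonzeroPairs n x y ha
  have hr := hasSum_multipleSum_mul_normalizedPowerSum_visiblePairs n x y ha
  exact ⟨hl.summable, hr.summable, hl.tsum_eq.trans hr.tsum_eq.symm⟩
end

section
/- Let m be a positive integer and let (a_k)_{k≥1} be a complex sequence with Σ_{n=1}^∞ n^{m+1}|a_n| < ∞. For each k ≥ 1 set S_k = Σ_{j=1}^∞ a_{jk}. Then Σ_{k=1}^∞ k^m a_k = S₁ + Σ_{k=2}^∞ S_k · J_m(k), where all series converge absolutely. -/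
/-- The Jordan totient `J_m(k)`: the number of `m`-tuples `(j₁,…,j_m)` of
integers with `0 ≤ jᵢ < k` for each `i` and `gcd(j₁,…,j_m,k) = 1`. -/
def jordanTotient (m k : ℕ) : ℕ :=
  (Finset.univ.filter (fun j : Fin m → Fin k =>
    Nat.gcd (Finset.univ.gcd fun i => (j i : ℕ)) k = 1)).card

/-- Multiplying by `e` identifies the primitive tuples modulo `d` with the tuples modulo `d * e`
whose common divisor with `d * e` is `e`. -/
lemma card_filter_gcd_eq_jordanTotient (m d e : ℕ) (he : 0 < e) :
    (Finset.univ.filter (fun j : Fin m → Fin (d * e) =>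
      Nat.gcd (Finset.univ.gcd fun i => (j i : ℕ)) (d * e) = e)).card = jordanTotient m d := by
  have gcd_scale (j : Fin m → ℕ) :
      Nat.gcd (Finset.univ.gcd fun i => j i * e) (d * e) = Nat.gcd (Finset.univ.gcd j) d * e := by
    rw [Finset.gcd_mul_right, normalize_eq, Nat.gcd_mul_right]
  symm
  refine Finset.card_bij
    (fun j _ i => ⟨(j i : ℕ) * e, Nat.mul_lt_mul_of_pos_right (j i).isLt he⟩) ?_ ?_ ?_
  · intro j hj
    simp only [Finset.mem_filter, Finset.mem_univ, true_and] at hj ⊢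
    rw [gcd_scale, hj, one_mul]
  · intro j _ j' _ h
    ext i
    have hi := congrArg Fin.val (congrFun h i)
    exact Nat.eq_of_mul_eq_mul_right he hi
  · intro j hj
    simp only [Finset.mem_filter, Finset.mem_univ, true_and] at hj
    have hdvd (i : Fin m) : e ∣ (j i : ℕ) :=
      (hj.symm.dvd.trans (Nat.gcd_dvd_left _ _)).trans (Finset.gcd_dvd (Finset.mem_univ i))
    have hdiv (i : Fin m) : (j i : ℕ) / e * e = j i := Nat.div_mul_cancel (hdvd i)
    refine ⟨fun i => ⟨(j i : ℕ) / e, Nat.div_lt_of_lt_mul <|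
      (j i).isLt.trans_eq (mul_comm d e)⟩, ?_, ?_⟩
    · simp only [Finset.mem_filter, Finset.mem_univ, true_and]
      refine Nat.eq_of_mul_eq_mul_right he ?_
      rw [← gcd_scale, one_mul]
      simpa only [hdiv] using hj
    · ext i
      exact hdiv i

lemma sum_divisorsAntidiagonal_jordanTotient (m : ℕ) {n : ℕ} (hn : 0 < n) :
    ∑ x ∈ n.divisorsAntidiagonal, jordanTotient m x.1 = n ^ m := by
  have hcard := Finset.card_eq_sum_card_fiberwise
    (s := (Finset.univ : Finset (Fin m → Fin n))) (t := n.divisors)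
    (f := fun j => Nat.gcd (Finset.univ.gcd fun i => (j i : ℕ)) n)
    (fun j _ => Nat.mem_divisors.2 ⟨Nat.gcd_dvd_right _ _, hn.ne'⟩)
  rw [Finset.card_univ, Fintype.card_fun, Fintype.card_fin, Fintype.card_fin] at hcard
  rw [hcard, Nat.sum_divisorsAntidiagonal' (fun x _ => jordanTotient m x)]
  refine Finset.sum_congr rfl fun e he => ?_
  obtain ⟨d, rfl⟩ := (Nat.mem_divisors.1 he).1
  have he0 : 0 < e := Nat.pos_of_mul_pos_right hn
  rw [Nat.mul_div_cancel_left d he0, mul_comm e d, card_filter_gcd_eq_jordanTotient m d e he0]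

lemma jordanTotient_one (m : ℕ) : jordanTotient m 1 = 1 := by
  simp [jordanTotient]

lemma multipleSum_eq_tsum_pnat (a : ℕ → ℂ) (k : ℕ) :
    multipleSum a k = ∑' j : ℕ+, a (k * j) := by
  rw [multipleSum, ← Equiv.pnatEquivNat.symm.tsum_eq]
  simp [mul_comm k]

lemma sum_antidiagonal_mul_jordanTotient {R : Type*} [CommSemiring R] (m : ℕ) (f : ℕ → R)
    (n : ℕ+) :
    ∑ x : Nat.divisorsAntidiagonal n, f (x.1.1 * x.1.2) * (jordanTotient m x.1.1 : R) =
      (n : R) ^ m * f n := by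
  rw [Finset.sum_coe_sort (Nat.divisorsAntidiagonal n)
    (fun x => f (x.1 * x.2) * (jordanTotient m x.1 : R))]
  rw [Finset.sum_congr rfl fun x hx => by rw [(Nat.mem_divisorsAntidiagonal.1 hx).1],
    ← Finset.mul_sum, ← Nat.cast_sum, sum_divisorsAntidiagonal_jordanTotient m n.pos,
    Nat.cast_pow, mul_comm]

lemma summable_mul_jordanTotient {m : ℕ} {a : ℕ → ℂ}
    (ha : Summable fun n : ℕ => (n : ℝ) ^ m * ‖a n‖) :
    Summable fun p : ℕ+ × ℕ+ => a (p.1 * p.2) * (jordanTotient m p.1 : ℂ) := by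
  refine Summable.of_norm ?_
  rw [← sigmaAntidiagonalEquivProd.summable_iff, Function.comp_def,
    summable_sigma_of_nonneg fun _ => norm_nonneg _]
  refine ⟨fun n => Summable.of_finite, ?_⟩
  refine (ha.comp_injective PNat.coe_injective).congr fun n => ?_
  rw [tsum_fintype]
  simpa [sigmaAntidiagonalEquivProd, divisorsAntidiagonalFactors] using
    (sum_antidiagonal_mul_jordanTotient m (fun n => ‖a n‖) n).symm

/-- If `Σ n^{m+1}|a_n| < ∞` and `S_k = Σ_{j≥1} a_{jk}`, then
`Σ_{k=1}^∞ k^m a_k = S₁ + Σ_{k=2}^∞ S_k J_m(k)`, all series converging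
absolutely. -/
theorem jordan_totient_summation (m : ℕ) (hm : 0 < m) (a : ℕ → ℂ)
    (ha : Summable fun n : ℕ => (n : ℝ) ^ (m + 1) * ‖a n‖) :
    Summable (fun k : ℕ => multipleSum a (k + 2) * (jordanTotient m (k + 2) : ℂ)) ∧
    HasSum (fun k : ℕ => ((k + 1 : ℕ) : ℂ) ^ m * a (k + 1))
      (multipleSum a 1 + ∑' k : ℕ, multipleSum a (k + 2) * (jordanTotient m (k + 2) : ℂ)) := by
  have ha' : Summable fun n : ℕ => (n : ℝ) ^ m * ‖a n‖ := by
    refine ha.of_nonneg_of_le (fun n => by positivity) fun n => ?_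
    refine mul_le_mul_of_nonneg_right ?_ (norm_nonneg _)
    rcases n.eq_zero_or_pos with rfl | hn
    · simp [hm.ne']
    · exact pow_le_pow_right₀ (by exact_mod_cast hn) m.le_succ
  have hF := summable_mul_jordanTotient ha'
  have hcol := hF.hasSum.prod_fiberwise fun k => (hF.prod_factor k).hasSum
  simp only [tsum_mul_right, ← multipleSum_eq_tsum_pnat] at hcol
  have hdiv := (sigmaAntidiagonalEquivProd.hasSum_iff.2 hF.hasSum).sigma
    fun n => hasSum_fintype _
  replace hdiv := hdiv.congr_fun (g := fun n : ℕ+ => (n : ℂ) ^ m * a n) fun n => by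
    simpa [sigmaAntidiagonalEquivProd, divisorsAntidiagonalFactors] using
      (sum_antidiagonal_mul_jordanTotient m a n).symm
  rw [← Equiv.pnatEquivNat.symm.hasSum_iff] at hcol hdiv
  have hshift := (summable_nat_add_iff 1).2 hcol.summable
  have htsum := hcol.tsum_eq.symm.trans hcol.summable.tsum_eq_zero_add
  simp only [Function.comp_def, Equiv.pnatEquivNat_symm_apply, Nat.succPNat_coe,
    Nat.succ_eq_add_one, add_assoc, zero_add, Nat.reduceAdd, jordanTotient_one, Nat.cast_one, mul_one]
    at hshift htsum hdiv
  refine ⟨hshift, ?_⟩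
  rwa [← htsum]
end

section
/- Let n be a positive integer, let (a_k)_{1≤k≤n} and (b_k)_{1≤k≤n} be complex numbers, and let x be a complex number such that exp(b_k x/k) ≠ 1 for every 1 ≤ k ≤ n. Then Σ_{k=1}^n a_k (1−exp(b_k x))/(1−exp(b_k x/k)) = Σ_{k=1}^n a_k + Σ_{m=2}^n Σ_{k=1}^{⌊n/m⌋} a_{mk} Σ_{j : 0<j<m, gcd(j,m)=1} exp(b_{mk}·jx/m). -/
open Finset in
/-- Writing each fraction `j / k` with `0 ≤ j < k` in lowest terms. -/
theorem sum_range_div_eq_sum_divisors_coprime {K M : Type*} [Field K] [CharZero K]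
    [AddCommMonoid M] (f : K → M) {k : ℕ} (hk : 0 < k) :
    ∑ j ∈ range k, f ((j : K) / k) =
      ∑ m ∈ k.divisors, ∑ j ∈ (range m).filter (fun j => Nat.Coprime j m), f ((j : K) / m) := by
  rw [sum_sigma']
  symm
  refine sum_nbij' (fun p => p.2 * (k / p.1))
    (fun j => ⟨k / Nat.gcd j k, j / Nat.gcd j k⟩) ?_ ?_ ?_ ?_ ?_
  · rintro ⟨m, j⟩ hp
    simp only [mem_sigma, Nat.mem_divisors, mem_filter, mem_range] at hp ⊢
    obtain ⟨⟨⟨c, rfl⟩, -⟩, hj, -⟩ := hp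
    rw [Nat.mul_div_cancel_left c (by omega)]
    exact Nat.mul_lt_mul_of_pos_right hj (Nat.pos_of_mul_pos_left hk)
  · intro j hj
    have hg : 0 < Nat.gcd j k := Nat.gcd_pos_of_pos_right j hk
    simp only [mem_sigma, Nat.mem_divisors, mem_filter, mem_range] at hj ⊢
    exact ⟨⟨Nat.div_dvd_of_dvd (Nat.gcd_dvd_right j k), hk.ne'⟩,
      Nat.div_lt_div_of_lt_of_dvd (Nat.gcd_dvd_right j k) hj, Nat.coprime_div_gcd_div_gcd hg⟩
  · rintro ⟨m, j⟩ hp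
    simp only [mem_sigma, Nat.mem_divisors, mem_filter, mem_range] at hp ⊢
    obtain ⟨⟨⟨c, rfl⟩, -⟩, hj, hjm⟩ := hp
    have hc : 0 < c := Nat.pos_of_mul_pos_left hk
    rw [Nat.mul_div_cancel_left c (by omega), Nat.gcd_mul_right, hjm.gcd_eq_one, one_mul,
      Nat.mul_div_cancel _ hc, Nat.mul_div_cancel _ hc]
  · intro j _
    dsimp only
    rw [Nat.div_div_self (Nat.gcd_dvd_right j k) hk.ne', Nat.div_mul_cancel (Nat.gcd_dvd_left j k)]
  · rintro ⟨m, j⟩ hp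
    simp only [mem_sigma, Nat.mem_divisors, mem_filter, mem_range] at hp ⊢
    obtain ⟨⟨⟨c, rfl⟩, -⟩, hj, -⟩ := hp
    have hc : (c : K) ≠ 0 := Nat.cast_ne_zero.mpr (Nat.pos_of_mul_pos_left hk).ne'
    rw [Nat.mul_div_cancel_left c (by omega), Nat.cast_mul, Nat.cast_mul,
      mul_div_mul_right _ _ hc]

open Finset in
/-- Exchanging a sum over `k ≤ n` with a sum over the divisors of `k`. -/
theorem sum_Icc_sum_divisors {M : Type*} [AddCommMonoid M] (n : ℕ) (F : ℕ → ℕ → M) :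
    ∑ k ∈ Icc 1 n, ∑ m ∈ k.divisors, F k m =
      ∑ m ∈ Icc 1 n, ∑ k ∈ Icc 1 (n / m), F (m * k) m := by
  rw [sum_sigma', sum_sigma']
  symm
  refine sum_nbij' (fun p => ⟨p.1 * p.2, p.1⟩) (fun p => ⟨p.2, p.1 / p.2⟩) ?_ ?_ ?_ ?_ ?_
  · rintro ⟨m, c⟩ hp
    simp only [mem_sigma, Nat.mem_divisors, mem_Icc] at hp ⊢
    obtain ⟨⟨hm, -⟩, hc, hcn⟩ := hp
    have hpos : 0 < m * c := Nat.mul_pos hm hc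
    exact ⟨⟨hpos, (Nat.mul_comm m c).le.trans (Nat.mul_le_of_le_div m c n hcn)⟩,
      Nat.dvd_mul_right m c, hpos.ne'⟩
  · rintro ⟨k, m⟩ hp
    simp only [mem_sigma, Nat.mem_divisors, mem_Icc] at hp ⊢
    obtain ⟨⟨hk, hkn⟩, hmk, -⟩ := hp
    have hm : 0 < m := Nat.pos_of_dvd_of_pos hmk hk
    have hle : m ≤ k := Nat.le_of_dvd hk hmk
    exact ⟨⟨hm, hle.trans hkn⟩, Nat.div_pos hle hm, Nat.div_le_div_right hkn⟩
  · rintro ⟨m, c⟩ hp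
    simp only [mem_sigma, mem_Icc] at hp
    dsimp only
    rw [Nat.mul_div_cancel_left c (by omega)]
  · rintro ⟨k, m⟩ hp
    simp only [mem_sigma, Nat.mem_divisors] at hp
    dsimp only
    rw [Nat.mul_div_cancel' hp.2.1]
  · intro _ _
    rfl


/-- The two-dimensional finite visible-point-vector summation formula:
`Σ_{k=1}^n a_k (1−e^{b_k x})/(1−e^{b_k x/k})
  = Σ_{k=1}^n a_k + Σ_{m=2}^n Σ_{k=1}^{⌊n/m⌋} a_{mk} Σ_{0<j<m, (j,m)=1} e^{b_{mk} jx/m}`. -/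
theorem vpv_summation_2d (n : ℕ) (hn : 0 < n) (a b : ℕ → ℂ) (x : ℂ)
    (h : ∀ k ∈ Finset.Icc 1 n, Complex.exp (b k * x / (k : ℂ)) ≠ 1) :
    ∑ k ∈ Finset.Icc 1 n,
        a k * (1 - Complex.exp (b k * x)) / (1 - Complex.exp (b k * x / (k : ℂ))) =
      (∑ k ∈ Finset.Icc 1 n, a k) +
        ∑ m ∈ Finset.Icc 2 n, ∑ k ∈ Finset.Icc 1 (n / m),
          a (m * k) * ∑ j ∈ (Finset.Ico 1 m).filter (fun j => Nat.Coprime j m),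
            Complex.exp (b (m * k) * (j : ℂ) * x / (m : ℂ)) := by
  have hterm : ∀ k ∈ Finset.Icc 1 n,
      a k * (1 - Complex.exp (b k * x)) / (1 - Complex.exp (b k * x / (k : ℂ))) =
        ∑ m ∈ k.divisors, a k * ∑ j ∈ (Finset.range m).filter (fun j => Nat.Coprime j m),
          Complex.exp (b k * x * ((j : ℂ) / m)) := by
    intro k hk
    have hpos : 0 < k := (Finset.mem_Icc.mp hk).1
    have hk0 : (k : ℂ) ≠ 0 := Nat.cast_ne_zero.mpr hpos.ne'
    rw [← Finset.mul_sum,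
      ← sum_range_div_eq_sum_divisors_coprime (fun z : ℂ => Complex.exp (b k * x * z)) hpos,
      mul_div_assoc]
    congr 1
    have hgeom := geom_sum_eq (h k hk) k
    rw [← Complex.exp_nat_mul, mul_div_cancel₀ _ hk0] at hgeom
    rw [← neg_div_neg_eq, neg_sub, neg_sub, ← hgeom]
    refine Finset.sum_congr rfl fun j _ => ?_
    rw [← Complex.exp_nat_mul]
    congr 1
    ring
  rw [Finset.sum_congr rfl hterm,
    sum_Icc_sum_divisors n (fun k m =>
      a k * ∑ j ∈ (Finset.range m).filter (fun j => Nat.Coprime j m),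
        Complex.exp (b k * x * ((j : ℂ) / m))),
    ← Finset.add_sum_Ioc_eq_sum_Icc hn]
  congr 1
  · simp
  · refine Finset.sum_congr rfl fun m hm => Finset.sum_congr rfl fun k _ => ?_
    have hm2 : 2 ≤ m := (Finset.mem_Icc.mp hm).1
    congr 1
    refine Finset.sum_congr ?_ fun j _ => ?_
    · ext j
      simp only [Finset.mem_filter, Finset.mem_range, Finset.mem_Ico]
      refine ⟨fun ⟨hj, hjm⟩ => ⟨⟨?_, hj⟩, hjm⟩, fun ⟨⟨_, hj⟩, hjm⟩ => ⟨hj, hjm⟩⟩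
      rcases Nat.eq_zero_or_pos j with rfl | hj0
      · rw [Nat.coprime_zero_left] at hjm
        omega
      · exact hj0
    · congr 1
      ring
end

section
/- For all real numbers x, y, z with 0 ≤ x < 1, 0 ≤ y < 1, 0 ≤ z < 1, the family (−(1/c)·log(1 − x^a y^b z^c)), indexed by triples (a,b,c) of integers with a ≥ 0, b ≥ 0, c ≥ 1, a < c, b < c and gcd(a,b,c) = 1, is summable, and its sum equals (1/((1−x)(1−y))) · log( ((1−xz)(1−yz)) / ((1−z)(1−xyz)) ). Equivalently, ∏_{(a,b,c)} (1 − x^a y^b z^c)^{−1/c} = ( ((1−xz)(1−yz)) / ((1−z)(1−xyz)) )^{1/((1−x)(1−y))}. -/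
/-- The visible lattice points `(a,b,c)` of the region `a,b ≥ 0`, `c ≥ 1`,
`a < c`, `b < c`, with `gcd(a,b,c) = 1`. -/
def VisibleTriple (p : ℕ × ℕ × ℕ) : Prop :=
  1 ≤ p.2.2 ∧ p.1 < p.2.2 ∧ p.2.1 < p.2.2 ∧ Nat.gcd p.1 (Nat.gcd p.2.1 p.2.2) = 1

/-- The triples `(a,b,c)` with `a < c` and `b < c`. -/
abbrev DominatedTriple : Type := {q : ℕ × ℕ × ℕ // q.1 < q.2.2 ∧ q.2.1 < q.2.2}

/-- Grouping dominated triples by their last coordinate. -/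
def sigmaFinEquivDominatedTriple : (Σ c : ℕ, Fin c × Fin c) ≃ DominatedTriple where
  toFun s := ⟨(s.2.1, s.2.2, s.1), s.2.1.2, s.2.2.2⟩
  invFun q := ⟨q.1.2.2, ⟨q.1.1, q.2.1⟩, ⟨q.1.2.1, q.2.2⟩⟩
  left_inv _ := rfl
  right_inv _ := rfl

/-- The positive multiple `(k+1)·p` of a visible triple `p`. -/
def VisibleTriple.multiple (s : Σ _ : {p : ℕ × ℕ × ℕ // VisibleTriple p}, ℕ) :
    DominatedTriple :=
  ⟨((s.2 + 1) * s.1.1.1, (s.2 + 1) * s.1.1.2.1, (s.2 + 1) * s.1.1.2.2),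
    Nat.mul_lt_mul_of_pos_left s.1.2.2.1 s.2.succ_pos,
    Nat.mul_lt_mul_of_pos_left s.1.2.2.2.1 s.2.succ_pos⟩

theorem VisibleTriple.multiple_bijective : Function.Bijective VisibleTriple.multiple := by
  constructor
  · rintro ⟨⟨⟨a, b, c⟩, h⟩, k⟩ ⟨⟨⟨a', b', c'⟩, h'⟩, k'⟩ heq
    simp only [VisibleTriple.multiple, Subtype.mk.injEq, Prod.mk.injEq] at heq
    obtain ⟨ha, hb, hc⟩ := heq
    have hg := h.2.2.2
    have hg' := h'.2.2.2
    dsimp only at hg hg'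
    have hk : k + 1 = k' + 1 := by
      have hgcd : Nat.gcd ((k + 1) * a) (Nat.gcd ((k + 1) * b) ((k + 1) * c)) =
          Nat.gcd ((k' + 1) * a') (Nat.gcd ((k' + 1) * b') ((k' + 1) * c')) := by
        rw [ha, hb, hc]
      simpa only [Nat.gcd_mul_left, hg, hg', mul_one] using hgcd
    rw [hk] at ha hb hc
    obtain rfl := Nat.eq_of_mul_eq_mul_left k'.succ_pos ha
    obtain rfl := Nat.eq_of_mul_eq_mul_left k'.succ_pos hb
    obtain rfl := Nat.eq_of_mul_eq_mul_left k'.succ_pos hc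
    obtain rfl := Nat.succ_injective hk
    rfl
  · rintro ⟨⟨a, b, c⟩, hac, hbc⟩
    dsimp only at hac hbc
    have hg : 0 < Nat.gcd a (Nat.gcd b c) :=
      Nat.gcd_pos_of_pos_right _ (Nat.gcd_pos_of_pos_right _ (by omega))
    obtain ⟨a', ha⟩ : Nat.gcd a (Nat.gcd b c) ∣ a := Nat.gcd_dvd_left _ _
    obtain ⟨b', hb⟩ : Nat.gcd a (Nat.gcd b c) ∣ b :=
      (Nat.gcd_dvd_right _ _).trans (Nat.gcd_dvd_left _ _)
    obtain ⟨c', hc⟩ : Nat.gcd a (Nat.gcd b c) ∣ c :=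
      (Nat.gcd_dvd_right _ _).trans (Nat.gcd_dvd_right _ _)
    obtain ⟨k, hk⟩ := Nat.exists_eq_succ_of_ne_zero hg.ne'
    have hg_mul : Nat.gcd a (Nat.gcd b c) * Nat.gcd a' (Nat.gcd b' c') =
        Nat.gcd a (Nat.gcd b c) := by
      rw [← Nat.gcd_mul_left, ← Nat.gcd_mul_left, ← ha, ← hb, ← hc]
    have hac' : a' < c' := by
      rw [ha, hc] at hac
      exact lt_of_mul_lt_mul_left (by simpa only [← ha, ← hb, ← hc] using hac) hg.le
    have hbc' : b' < c' := by
      rw [hb, hc] at hbc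
      exact lt_of_mul_lt_mul_left (by simpa only [← ha, ← hb, ← hc] using hbc) hg.le
    refine ⟨⟨⟨(a', b', c'), ?_, hac', hbc', ?_⟩, k⟩, ?_⟩
    · exact Nat.one_le_iff_ne_zero.2 (by dsimp only; omega)
    · exact Nat.eq_of_mul_eq_mul_left hg (by rw [hg_mul, mul_one])
    · rw [hk] at ha hb hc
      simp only [VisibleTriple.multiple, Subtype.mk.injEq, Prod.mk.injEq]
      exact ⟨ha.symm, hb.symm, hc.symm⟩

/-- The Taylor series of `-log (1 - t)`, including its vanishing constant term. -/
theorem hasSum_pow_div_neg_log {t : ℝ} (h0 : 0 ≤ t) (h1 : t < 1) :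
    HasSum (fun n : ℕ => t ^ n / n) (-Real.log (1 - t)) := by
  rw [← hasSum_nat_add_iff' 1]
  simpa using Real.hasSum_pow_div_log_of_abs_lt_one (abs_lt.2 ⟨by linarith, h1⟩)

theorem hasSum_dominatedTriple {x y z : ℝ} (hx0 : 0 ≤ x) (hx1 : x < 1) (hy0 : 0 ≤ y)
    (hy1 : y < 1) (hz0 : 0 ≤ z) (hz1 : z < 1) :
    HasSum (fun q : DominatedTriple => x ^ q.1.1 * y ^ q.1.2.1 * z ^ q.1.2.2 / q.1.2.2)
      ((1 / ((1 - x) * (1 - y))) *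
        Real.log (((1 - x * z) * (1 - y * z)) / ((1 - z) * (1 - x * y * z)))) := by
  have hxz : x * z < 1 := mul_lt_one_of_nonneg_of_lt_one_left hx0 hx1 hz1.le
  have hyz : y * z < 1 := mul_lt_one_of_nonneg_of_lt_one_left hy0 hy1 hz1.le
  have hxyz : x * y * z < 1 := by
    rw [mul_assoc]
    exact mul_lt_one_of_nonneg_of_lt_one_left hx0 hx1 hyz.le
  have hfiber (c : ℕ) : ∑ s : Fin c × Fin c, x ^ (s.1 : ℕ) * y ^ (s.2 : ℕ) * z ^ c / c =
      (1 / ((1 - x) * (1 - y))) *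
        (z ^ c / c - (x * z) ^ c / c - (y * z) ^ c / c + (x * y * z) ^ c / c) := by
    have hgeom {t : ℝ} (ht : t < 1) : ∑ i : Fin c, t ^ (i : ℕ) = (1 - t ^ c) / (1 - t) := by
      rw [Fin.sum_univ_eq_sum_range (fun i => t ^ i), eq_div_iff (by linarith),
        geom_sum_mul_neg]
    have hprod : ∑ s : Fin c × Fin c, x ^ (s.1 : ℕ) * y ^ (s.2 : ℕ) =
        (1 - x ^ c) / (1 - x) * ((1 - y ^ c) / (1 - y)) := by
      rw [Fintype.sum_prod_type, ← hgeom hx1, ← hgeom hy1, Finset.sum_mul_sum]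
    rw [← Finset.sum_div, ← Finset.sum_mul, hprod]
    have hx : 1 - x ≠ 0 := by linarith
    have hy : 1 - y ≠ 0 := by linarith
    simp only [mul_pow]
    field_simp
    ring
  have hsum : HasSum (fun c : ℕ => ∑ s : Fin c × Fin c,
      x ^ (s.1 : ℕ) * y ^ (s.2 : ℕ) * z ^ c / c)
      ((1 / ((1 - x) * (1 - y))) *
        Real.log (((1 - x * z) * (1 - y * z)) / ((1 - z) * (1 - x * y * z)))) := by
    simp only [hfiber]
    have h := (((hasSum_pow_div_neg_log hz0 hz1).sub
      (hasSum_pow_div_neg_log (mul_nonneg hx0 hz0) hxz)).sub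
      (hasSum_pow_div_neg_log (mul_nonneg hy0 hz0) hyz)).add
      (hasSum_pow_div_neg_log (mul_nonneg (mul_nonneg hx0 hy0) hz0) hxyz)
    have h1 : 1 - z ≠ 0 := by linarith
    have h2 : 1 - x * z ≠ 0 := by linarith
    have h3 : 1 - y * z ≠ 0 := by linarith
    have h4 : 1 - x * y * z ≠ 0 := by linarith
    have hlog : Real.log (((1 - x * z) * (1 - y * z)) / ((1 - z) * (1 - x * y * z))) =
        -Real.log (1 - z) - -Real.log (1 - x * z) - -Real.log (1 - y * z) +
          -Real.log (1 - x * y * z) := by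
      rw [Real.log_div (mul_ne_zero h2 h3) (mul_ne_zero h1 h4), Real.log_mul h2 h3,
        Real.log_mul h1 h4]
      ring
    rw [hlog]
    exact h.mul_left _
  rw [← sigmaFinEquivDominatedTriple.hasSum_iff]
  refine HasSum.sigma_of_hasSum hsum (fun c => hasSum_fintype _) ?_
  refine (summable_sigma_of_nonneg fun s => ?_).2 ⟨fun c => Summable.of_finite, ?_⟩
  · simp only [Function.comp_apply]
    positivity
  · simp only [tsum_fintype]
    exact hsum.summable

theorem VisibleTriple.pow_mul_pow_mul_pow_lt_one {x y z : ℝ} (hx0 : 0 ≤ x) (hx1 : x < 1)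
    (hy0 : 0 ≤ y) (hy1 : y < 1) (hz0 : 0 ≤ z) (hz1 : z < 1) {p : ℕ × ℕ × ℕ}
    (hp : VisibleTriple p) : x ^ p.1 * y ^ p.2.1 * z ^ p.2.2 < 1 :=
  mul_lt_one_of_nonneg_of_lt_one_right
    (mul_le_one₀ (pow_le_one₀ hx0 hx1.le) (pow_nonneg hy0 _) (pow_le_one₀ hy0 hy1.le))
    (pow_nonneg hz0 _) (pow_lt_one₀ hz0 hz1 (Nat.one_le_iff_ne_zero.1 hp.1))

/-- For `0 ≤ x,y,z < 1`, the family `−(1/c)·log(1−x^a y^b z^c)` over visible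
triples `(a,b,c)` is summable with sum
`(1/((1−x)(1−y)))·log(((1−xz)(1−yz))/((1−z)(1−xyz)))`; equivalently,
`∏ (1−x^a y^b z^c)^{−1/c} = (((1−xz)(1−yz))/((1−z)(1−xyz)))^{1/((1−x)(1−y))}`. -/
theorem vpv_product_3d (x y z : ℝ) (hx0 : 0 ≤ x) (hx1 : x < 1) (hy0 : 0 ≤ y)
    (hy1 : y < 1) (hz0 : 0 ≤ z) (hz1 : z < 1) :
    HasSum (fun p : {p : ℕ × ℕ × ℕ // VisibleTriple p} =>
        -(1 / (p.1.2.2 : ℝ)) * Real.log (1 - x ^ p.1.1 * y ^ p.1.2.1 * z ^ p.1.2.2))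
      ((1 / ((1 - x) * (1 - y))) *
        Real.log (((1 - x * z) * (1 - y * z)) / ((1 - z) * (1 - x * y * z)))) ∧
    (∏' p : {p : ℕ × ℕ × ℕ // VisibleTriple p},
        (1 - x ^ p.1.1 * y ^ p.1.2.1 * z ^ p.1.2.2) ^ (-(1 / (p.1.2.2 : ℝ)))) =
      (((1 - x * z) * (1 - y * z)) / ((1 - z) * (1 - x * y * z))) ^
        (1 / ((1 - x) * (1 - y))) := by
  have ht {p : ℕ × ℕ × ℕ} (hp : VisibleTriple p) : x ^ p.1 * y ^ p.2.1 * z ^ p.2.2 < 1 :=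
    hp.pow_mul_pow_mul_pow_lt_one hx0 hx1 hy0 hy1 hz0 hz1
  have hsum : HasSum (fun p : {p : ℕ × ℕ × ℕ // VisibleTriple p} =>
      -(1 / (p.1.2.2 : ℝ)) * Real.log (1 - x ^ p.1.1 * y ^ p.1.2.1 * z ^ p.1.2.2))
      ((1 / ((1 - x) * (1 - y))) *
        Real.log (((1 - x * z) * (1 - y * z)) / ((1 - z) * (1 - x * y * z)))) := by
    refine ((Equiv.ofBijective _ VisibleTriple.multiple_bijective).hasSum_iff.2
      (hasSum_dominatedTriple hx0 hx1 hy0 hy1 hz0 hz1)).sigma fun p => ?_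
    have ht0 : 0 ≤ x ^ p.1.1 * y ^ p.1.2.1 * z ^ p.1.2.2 := by positivity
    have h := (Real.hasSum_pow_div_log_of_abs_lt_one
      (abs_lt.2 ⟨by linarith, ht p.2⟩)).mul_left (1 / (p.1.2.2 : ℝ))
    rw [mul_neg, ← neg_mul] at h
    refine h.congr_fun fun k => ?_
    simp only [Function.comp_apply, Equiv.ofBijective_apply, VisibleTriple.multiple]
    push_cast
    rw [one_div_mul_eq_div, div_div, mul_pow, mul_pow, ← pow_mul, ← pow_mul, ← pow_mul]
    simp only [mul_comm]
  refine ⟨hsum, ?_⟩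
  have hbase : 0 < ((1 - x * z) * (1 - y * z)) / ((1 - z) * (1 - x * y * z)) := by
    have hxz : x * z < 1 := mul_lt_one_of_nonneg_of_lt_one_left hx0 hx1 hz1.le
    have hyz : y * z < 1 := mul_lt_one_of_nonneg_of_lt_one_left hy0 hy1 hz1.le
    have hxyz : x * y * z < 1 := by
      rw [mul_assoc]
      exact mul_lt_one_of_nonneg_of_lt_one_left hx0 hx1 hyz.le
    exact div_pos (mul_pos (by linarith) (by linarith)) (mul_pos (by linarith) (by linarith))
  rw [Real.rpow_def_of_pos hbase, mul_comm (Real.log _), ← hsum.rexp.tprod_eq]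
  refine tprod_congr fun p => ?_
  rw [Real.rpow_def_of_pos (sub_pos.2 (ht p.2)), mul_comm, Function.comp_apply]
end
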